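/- Let α, β > 0 with α + β > 1. There exists a constant C > 0, depending only on α and β, such that for every m ∈ ℤ², Σ_{l} (1+|m−l|²)^{-α}·(1+|l|²)^{-β} ≤ C·(1+|m|²)^{1−α−β}, where the sum runs over all l ∈ ℤ² satisfying |m|/2 ≤ |l| ≤ 2|m| and |l−m| ≥ |m|/2. -/

import Mathlib

open scoped BigOperators

/-- Squared Euclidean norm of a lattice point of `ℤ²`. -/
noncomputable def nsq (m : ℤ × ℤ) : ℝ := (m.1 : ℝ) ^ 2 + (m.2 : ℝ) ^ 2

/-- Euclidean norm of a lattice point of `ℤ²`. -/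
noncomputable def norm2 (m : ℤ × ℤ) : ℝ := Real.sqrt (nsq m)

theorem nsq_nonneg' (m : ℤ × ℤ) : 0 ≤ nsq m := by
  unfold nsq; positivity

theorem term_bound (γ x y : ℝ) (hγ : 0 < γ) (hx : 0 ≤ x) (hy : x / 4 ≤ y) :
    (1 + y) ^ (-γ) ≤ 4 ^ γ * (1 + x) ^ (-γ) := by
  have h1 : (1 + y) ^ (-γ) ≤ ((1 + x) / 4) ^ (-γ) :=
    Real.rpow_le_rpow_of_nonpos (by linarith) (by linarith) (by linarith)
  have h2 : ((1 + x) / 4) ^ (-γ) = 4 ^ γ * (1 + x) ^ (-γ) := by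
    rw [Real.div_rpow (by linarith) (by norm_num), Real.rpow_neg (by norm_num : (0:ℝ) ≤ 4),
      div_inv_eq_mul, mul_comm]
  rw [← h2]; exact h1

theorem sq_of_half_le (m l : ℤ × ℤ) (h : norm2 m / 2 ≤ norm2 l) : nsq m / 4 ≤ nsq l := by
  unfold norm2 at h
  have h1 := Real.sq_sqrt (nsq_nonneg' m)
  have h2 := Real.sq_sqrt (nsq_nonneg' l)
  have h3 := Real.sqrt_nonneg (nsq m)
  nlinarith

theorem abs_le_of_sq (a b R : ℝ) (h : Real.sqrt (a ^ 2 + b ^ 2) ≤ R) : |a| ≤ R :=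
  (Real.abs_le_sqrt (by nlinarith [sq_nonneg b])).trans h

theorem mem_box (a : ℤ) (R : ℝ) (h : |(a : ℝ)| ≤ R) : a ∈ Finset.Icc (-⌊R⌋) ⌊R⌋ := by
  rw [abs_le] at h
  rw [Finset.mem_Icc]
  refine ⟨?_, Int.le_floor.2 h.2⟩
  have : -a ≤ ⌊R⌋ := Int.le_floor.2 (by push_cast; linarith)
  linarith

theorem stmt_4 (α β : ℝ) (hα : 0 < α) (hβ : 0 < β) (hαβ : 1 < α + β) :
    ∃ C : ℝ, 0 < C ∧
      ∀ m : ℤ × ℤ,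
        (∑' l : ℤ × ℤ,
            Set.indicator
              {l : ℤ × ℤ | norm2 m / 2 ≤ norm2 l ∧ norm2 l ≤ 2 * norm2 m ∧
                norm2 m / 2 ≤ norm2 (l - m)}
              (fun l => (1 + nsq (m - l)) ^ (-α) * (1 + nsq l) ^ (-β)) l)
          ≤ C * (1 + nsq m) ^ (1 - α - β) := by
  refine ⟨32 * 4 ^ (α + β), by positivity, fun m => ?_⟩
  have hm := nsq_nonneg' m
  set R : ℝ := 2 * norm2 m with hR
  have hR0 : 0 ≤ R := by
    have := Real.sqrt_nonneg (nsq m)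
    simp only [hR, norm2]; linarith
  have hR2 : R ^ 2 = 4 * nsq m := by
    simp only [hR, norm2, mul_pow, Real.sq_sqrt hm]; norm_num
  set B : Finset (ℤ × ℤ) := Finset.Icc (-⌊R⌋) ⌊R⌋ ×ˢ Finset.Icc (-⌊R⌋) ⌊R⌋ with hB
  have hcard : (B.card : ℝ) ≤ 32 * (1 + nsq m) := by
    have hf : 0 ≤ ⌊R⌋ := Int.floor_nonneg.2 hR0
    have hfR : (⌊R⌋ : ℝ) ≤ R := Int.floor_le R
    have hf' : (0 : ℝ) ≤ (⌊R⌋ : ℝ) := by exact_mod_cast hf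
    have hc : ((Finset.Icc (-⌊R⌋) ⌊R⌋).card : ℝ) = 2 * (⌊R⌋ : ℝ) + 1 := by
      have h : (((Finset.Icc (-⌊R⌋) ⌊R⌋).card : ℤ)) = 2 * ⌊R⌋ + 1 := by
        rw [Int.card_Icc, Int.toNat_of_nonneg (by linarith)]; ring
      exact_mod_cast h
    rw [hB, Finset.card_product, Nat.cast_mul, hc]
    nlinarith [sq_nonneg (2 * R - 1)]
  have hpos : 0 < 1 + nsq m := by linarith
  have hbound : ∀ l ∈ B, Set.indicator
              {l : ℤ × ℤ | norm2 m / 2 ≤ norm2 l ∧ norm2 l ≤ R ∧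
                norm2 m / 2 ≤ norm2 (l - m)}
              (fun l => (1 + nsq (m - l)) ^ (-α) * (1 + nsq l) ^ (-β)) l
      ≤ (4 ^ α * (1 + nsq m) ^ (-α)) * (4 ^ β * (1 + nsq m) ^ (-β)) := by
    intro l _
    apply Set.indicator_apply_le'
    · rintro ⟨h1, _, h3⟩
      have e : nsq (m - l) = nsq (l - m) := by
        simp only [nsq, Prod.fst_sub, Prod.snd_sub]; push_cast; ring
      have hl := nsq_nonneg' l
      rw [e]
      exact mul_le_mul (term_bound α _ _ hα hm (sq_of_half_le _ _ h3))
        (term_bound β _ _ hβ hm (sq_of_half_le _ _ h1)) (by positivity) (by positivity)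
    · intro _; positivity
  rw [tsum_eq_sum (s := B)]
  · refine (Finset.sum_le_card_nsmul _ _ _ hbound).trans ?_
    rw [nsmul_eq_mul]
    have e1 : (1 + nsq m) ^ (1 - α - β)
        = (1 + nsq m) * ((1 + nsq m) ^ (-α) * (1 + nsq m) ^ (-β)) := by
      rw [← Real.rpow_add hpos, ← Real.rpow_one_add' hpos.le (by linarith)]
      congr 1; ring
    rw [e1, Real.rpow_add (by norm_num : (0:ℝ) < 4)]
    calc _ ≤ 32 * (1 + nsq m) * (4 ^ α * (1 + nsq m) ^ (-α) * (4 ^ β * (1 + nsq m) ^ (-β))) :=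
          mul_le_mul_of_nonneg_right hcard (by positivity)
      _ = _ := by ring
  · intro l hl
    apply Set.indicator_of_notMem
    rintro ⟨_, h2, _⟩
    apply hl
    rw [hB, Finset.mem_product]
    unfold norm2 nsq at h2
    exact ⟨mem_box _ _ (abs_le_of_sq _ _ _ h2),
      mem_box _ _ (abs_le_of_sq _ _ _ (by rw [add_comm]; exact h2))⟩
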